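/- arXiv:2411.09004 — 2 statements merged into one kernel-verified Lean document; each statement's English description precedes it below -/
import Mathlib

section
/- (End-to-end dynamics, Arora–Cohen–Hazan.) Let E : M_d → ℝ be C¹ and let 𝐖 : I → M_d^N be a differentiable solution of the DLN gradient flow Ẇ_p = −(W_N⋯W_{p+1})ᵀ E'(W) (W_{p−1}⋯W_1)ᵀ, p = 1,…,N. Then the end-to-end matrix W(t) = W_N(t)⋯W_1(t) satisfies the closed equation Ẇ = −∑_{p=1}^N (A_{p+1} A_{p+1}ᵀ) E'(W) (B_{p−1}ᵀ B_{p−1}), where A_p = W_N⋯W_p and B_p = W_p⋯W_1 for 1 ≤ p ≤ N, and A_{N+1} = B_0 = I. -/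
open Matrix BigOperators

attribute [local instance] Matrix.normedAddCommGroup Matrix.normedSpace

noncomputable def mpow {d : ℕ} (P : Matrix (Fin d) (Fin d) ℝ) (s : ℝ) :
    Matrix (Fin d) (Fin d) ℝ :=
  if h : P.IsHermitian then
    (h.eigenvectorUnitary : Matrix (Fin d) (Fin d) ℝ) *
      Matrix.diagonal (fun i => (h.eigenvalues i) ^ s) *
      star (h.eigenvectorUnitary : Matrix (Fin d) (Fin d) ℝ)
  else 0

def Bprod {d : ℕ} (W : ℕ → Matrix (Fin d) (Fin d) ℝ) (p : ℕ) : Matrix (Fin d) (Fin d) ℝ :=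
  ((List.range p).map (fun i => W (p - i))).prod

def Aprod {d : ℕ} (W : ℕ → Matrix (Fin d) (Fin d) ℝ) (N p : ℕ) : Matrix (Fin d) (Fin d) ℝ :=
  ((List.range (N + 1 - p)).map (fun i => W (N - i))).prod

def BalancedTuple {d : ℕ} (N : ℕ) (W : ℕ → Matrix (Fin d) (Fin d) ℝ) : Prop :=
  ∀ p, 1 ≤ p → p < N → (W (p+1))ᵀ * W (p+1) = W p * (W p)ᵀ

noncomputable def frobCLM {d : ℕ} (G : Matrix (Fin d) (Fin d) ℝ) :
    Matrix (Fin d) (Fin d) ℝ →L[ℝ] ℝ :=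
  LinearMap.toContinuousLinearMap
    { toFun := fun Z => (Gᵀ * Z).trace
      map_add' := fun x y => by simp [Matrix.mul_add]
      map_smul' := fun c x => by simp [Matrix.mul_smul] }


theorem hasDerivAt_matrix_mul {d : ℕ} {f g : ℝ → Matrix (Fin d) (Fin d) ℝ}
    {f' g' : Matrix (Fin d) (Fin d) ℝ} {t : ℝ}
    (hf : HasDerivAt f f' t) (hg : HasDerivAt g g' t) :
    HasDerivAt (fun τ => f τ * g τ) (f' * g t + f t * g') t := by
  refine hasDerivAt_pi.2 fun i => hasDerivAt_pi.2 fun j => ?_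
  have entry : ∀ {h : ℝ → Matrix (Fin d) (Fin d) ℝ} {h' : Matrix (Fin d) (Fin d) ℝ},
      HasDerivAt h h' t → ∀ a b, HasDerivAt (fun τ => h τ a b) (h' a b) t :=
    fun hh a b => hasDerivAt_pi.1 (hasDerivAt_pi.1 hh a) b
  simp only [Matrix.mul_apply, Matrix.add_apply, ← Finset.sum_add_distrib]
  exact HasDerivAt.fun_sum fun k _ => (entry hf i k).mul (entry hg k j)

theorem Bprod_zero {d : ℕ} (W : ℕ → Matrix (Fin d) (Fin d) ℝ) : Bprod W 0 = 1 := by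
  simp [Bprod]

theorem Bprod_succ {d : ℕ} (W : ℕ → Matrix (Fin d) (Fin d) ℝ) (n : ℕ) :
    Bprod W (n + 1) = W (n + 1) * Bprod W n := by
  simp [Bprod, List.range_succ_eq_map, Function.comp_def, Nat.add_sub_add_right]

theorem Aprod_self_succ {d : ℕ} (W : ℕ → Matrix (Fin d) (Fin d) ℝ) (n : ℕ) :
    Aprod W n (n + 1) = 1 := by
  simp [Aprod]

theorem Aprod_succ {d : ℕ} (W : ℕ → Matrix (Fin d) (Fin d) ℝ) {n p : ℕ} (h : p ≤ n + 1) :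
    Aprod W (n + 1) p = W (n + 1) * Aprod W n p := by
  have hlen : n + 1 + 1 - p = (n + 1 - p) + 1 := by omega
  simp [Aprod, hlen, List.range_succ_eq_map, Function.comp_def, Nat.add_sub_add_right]

theorem hasDerivAt_Bprod {d : ℕ} {W : ℕ → ℝ → Matrix (Fin d) (Fin d) ℝ}
    {W' : ℕ → Matrix (Fin d) (Fin d) ℝ} {t : ℝ} (N : ℕ)
    (hW : ∀ p, 1 ≤ p → p ≤ N → HasDerivAt (W p) (W' p) t) :
    HasDerivAt (fun τ => Bprod (fun q => W q τ) N)
      (∑ p ∈ Finset.Icc 1 N,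
        Aprod (fun q => W q t) N (p + 1) * W' p * Bprod (fun q => W q t) (p - 1)) t := by
  induction N with
  | zero =>
    simp only [Bprod_zero, Finset.Icc_eq_empty_of_lt zero_lt_one, Finset.sum_empty]
    exact hasDerivAt_const t (1 : Matrix (Fin d) (Fin d) ℝ)
  | succ n ih =>
    have hmul := hasDerivAt_matrix_mul (hW (n + 1) (by omega) le_rfl)
      (ih fun p h₁ h₂ => hW p h₁ (by omega))
    simp only [Bprod_succ]
    convert hmul using 1
    rw [Finset.sum_Icc_succ_top (by omega), Aprod_self_succ, one_mul, Nat.add_sub_cancel,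
      add_comm, Finset.mul_sum]
    congr 1
    refine Finset.sum_congr rfl fun p hp => ?_
    rw [Aprod_succ _ (by have := (Finset.mem_Icc.1 hp).2; omega)]
    simp only [Matrix.mul_assoc]

/-- **Arora–Cohen–Hazan: end-to-end dynamics.**
Along any solution of the DLN gradient flow, the end-to-end matrix
`W = W_N ⋯ W_1` satisfies
`Ẇ = −∑_{p=1}^N (A_{p+1}A_{p+1}ᵀ) E'(W) (B_{p−1}ᵀ B_{p−1})`
with `A_p = W_N⋯W_p`, `B_p = W_p⋯W_1`, `A_{N+1} = B_0 = I`. -/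
theorem dln_end_to_end {d N : ℕ} (hN : 1 ≤ N)
    (E : Matrix (Fin d) (Fin d) ℝ → ℝ)
    (G : Matrix (Fin d) (Fin d) ℝ → Matrix (Fin d) (Fin d) ℝ)
    (hE : ∀ X, HasFDerivAt E (frobCLM (G X)) X) (hG : Continuous G)
    (I : Set ℝ) (hI : Convex ℝ I)
    (W : ℕ → ℝ → Matrix (Fin d) (Fin d) ℝ)
    (hflow : ∀ p, 1 ≤ p → p ≤ N → ∀ t ∈ I,
      HasDerivAt (W p)
        (-((Aprod (fun q => W q t) N (p + 1))ᵀ * G (Bprod (fun q => W q t) N) *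
            (Bprod (fun q => W q t) (p - 1))ᵀ)) t) :
    ∀ t ∈ I,
      HasDerivAt (fun τ => Bprod (fun q => W q τ) N)
        (-(∑ p ∈ Finset.Icc 1 N,
            Aprod (fun q => W q t) N (p + 1) * (Aprod (fun q => W q t) N (p + 1))ᵀ *
              G (Bprod (fun q => W q t) N) *
              ((Bprod (fun q => W q t) (p - 1))ᵀ * Bprod (fun q => W q t) (p - 1)))) t := by
  intro t ht
  convert hasDerivAt_Bprod N fun p h₁ h₂ => hflow p h₁ h₂ t ht using 1
  rw [← Finset.sum_neg_distrib]
  refine Finset.sum_congr rfl fun p _ => ?_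
  simp only [Matrix.mul_neg, Matrix.neg_mul, Matrix.mul_assoc]
end

section
/- (Spectral decomposition of the infinite-depth operator.) Let W ∈ M_d have singular value decomposition W = ∑_{j=1}^d σ_j u_j v_jᵀ with {u_j}, {v_j} orthonormal bases of ℝ^d and σ_j > 0 for all j, and define A_{∞,W} : M_d → M_d by A_{∞,W}(Z) = ∫₀¹ (WWᵀ)^{1−s} Z (WᵀW)^s ds (a Bochner integral of a continuous matrix-valued function). Then for all 1 ≤ k, l ≤ d with σ_k ≠ σ_l, A_{∞,W}(u_k v_lᵀ) = ((σ_k² − σ_l²)/(2 log(σ_k/σ_l))) u_k v_lᵀ, and A_{∞,W}(u_k v_kᵀ) = σ_k² u_k v_kᵀ for every k. -/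
open Matrix BigOperators

attribute [local instance] Matrix.normedAddCommGroup Matrix.normedSpace

theorem mpow_mulVec_of_eigenvector {d : ℕ} {P : Matrix (Fin d) (Fin d) ℝ} (hP : P.IsHermitian)
    {x : Fin d → ℝ} {c : ℝ} (hx : P *ᵥ x = c • x) (s : ℝ) :
    mpow P s *ᵥ x = c ^ s • x := by
  set E : Matrix (Fin d) (Fin d) ℝ := (hP.eigenvectorUnitary : Matrix (Fin d) (Fin d) ℝ) with hE
  have hEE : star E * E = 1 := Unitary.coe_star_mul_self hP.eigenvectorUnitary
  have hEE' : E * star E = 1 := Unitary.coe_mul_star_self hP.eigenvectorUnitary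
  have hspec : P = E * diagonal hP.eigenvalues * star E := by
    simpa [Unitary.conjStarAlgAut_apply, hE] using hP.spectral_theorem
  have hy : diagonal hP.eigenvalues *ᵥ (star E *ᵥ x) = c • (star E *ᵥ x) := by
    rw [← mulVec_smul, ← hx]
    conv_rhs => rw [hspec]
    simp only [mulVec_mulVec, ← Matrix.mul_assoc, hEE, Matrix.one_mul]
  have hys : diagonal (fun i => hP.eigenvalues i ^ s) *ᵥ (star E *ᵥ x)
      = c ^ s • (star E *ᵥ x) := by
    ext i
    have hi := congrFun hy i
    simp only [mulVec_diagonal, Pi.smul_apply, smul_eq_mul] at hi ⊢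
    by_cases h0 : (star E *ᵥ x) i = 0
    · simp [h0]
    · rw [mul_right_cancel₀ h0 hi]
  rw [mpow, dif_pos hP, ← mulVec_mulVec, ← mulVec_mulVec, hys, mulVec_smul, mulVec_mulVec,
    hEE', one_mulVec]

theorem mpow_transpose {d : ℕ} (P : Matrix (Fin d) (Fin d) ℝ) (s : ℝ) :
    (mpow P s)ᵀ = mpow P s := by
  unfold mpow
  split_ifs
  · simp [Matrix.transpose_mul, star_eq_conjTranspose, Matrix.mul_assoc]
  · simp

theorem sum_smul_vecMulVec_mulVec {d : ℕ} {U V : Matrix (Fin d) (Fin d) ℝ} (σ : Fin d → ℝ)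
    (hV : Vᵀ * V = 1) (k : Fin d) :
    (∑ j, σ j • vecMulVec (fun i => U i j) (fun i => V i j)) *ᵥ (fun i => V i k)
      = σ k • fun i => U i k := by
  have h (j : Fin d) : (fun i => V i j) ⬝ᵥ (fun i => V i k) = if j = k then 1 else 0 := by
    have := congrFun (congrFun hV j) k
    rwa [Matrix.one_apply] at this
  ext i
  simp [Matrix.sum_mulVec, smul_mulVec, vecMulVec_mulVec, h, ite_apply]

theorem integral_rpow_one_sub_mul_rpow {a b : ℝ} (ha : 0 < a) (hb : 0 < b) (hab : a ≠ b) :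
    ∫ s in (0:ℝ)..1, a ^ (1 - s) * b ^ s = (a - b) / Real.log (a / b) := by
  have hlog : Real.log b - Real.log a ≠ 0 :=
    sub_ne_zero.2 fun h => hab (Real.log_injOn_pos hb ha h).symm
  have hlog' : Real.log a - Real.log b ≠ 0 := by rwa [← neg_ne_zero, neg_sub]
  have hfun (s : ℝ) : a ^ (1 - s) * b ^ s = a * Real.exp ((Real.log b - Real.log a) * s) := by
    rw [Real.rpow_def_of_pos ha, Real.rpow_def_of_pos hb]
    calc Real.exp (Real.log a * (1 - s)) * Real.exp (Real.log b * s)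
        = Real.exp (Real.log a) * Real.exp ((Real.log b - Real.log a) * s) := by
          rw [← Real.exp_add, ← Real.exp_add]
          ring_nf
      _ = _ := by rw [Real.exp_log ha]
  simp_rw [hfun]
  rw [intervalIntegral.integral_const_mul, intervalIntegral.integral_comp_mul_left _ hlog,
    integral_exp, Real.log_div ha.ne' hb.ne', mul_one, mul_zero, Real.exp_zero, Real.exp_sub,
    Real.exp_log ha, Real.exp_log hb, smul_eq_mul]
  field_simp
  rw [← neg_sub (Real.log a)]
  field_simp
  ring

open intervalIntegral in
/-- **spectral decomposition of the infinite-depth operator.**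
For `W = ∑_j σ_j u_j v_jᵀ` with positive singular values,
`A_{∞,W}(Z) = ∫₀¹ (WWᵀ)^{1−s} Z (WᵀW)^s ds` satisfies
`A_{∞,W}(u_k v_lᵀ) = ((σ_k²−σ_l²)/(2 log(σ_k/σ_l))) u_k v_lᵀ` for `σ_k ≠ σ_l`
and `A_{∞,W}(u_k v_kᵀ) = σ_k² u_k v_kᵀ`. -/
theorem dln_infinite_depth_spectrum {d : ℕ}
    (U V : Matrix (Fin d) (Fin d) ℝ) (σ : Fin d → ℝ)
    (hU : Uᵀ * U = 1) (hV : Vᵀ * V = 1) (hσ : ∀ i, 0 < σ i)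
    (W : Matrix (Fin d) (Fin d) ℝ)
    (hW : W = ∑ j, σ j • Matrix.vecMulVec (fun i => U i j) (fun i => V i j)) :
    ∀ k l : Fin d,
      (σ k ≠ σ l →
        (∫ s in (0:ℝ)..1,
            mpow (W * Wᵀ) (1 - s) *
              Matrix.vecMulVec (fun i => U i k) (fun i => V i l) *
              mpow (Wᵀ * W) s)
          = ((σ k ^ 2 - σ l ^ 2) / (2 * Real.log (σ k / σ l))) •
              Matrix.vecMulVec (fun i => U i k) (fun i => V i l))
      ∧ (∫ s in (0:ℝ)..1,
            mpow (W * Wᵀ) (1 - s) *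
              Matrix.vecMulVec (fun i => U i k) (fun i => V i k) *
              mpow (Wᵀ * W) s)
          = (σ k ^ 2) •
              Matrix.vecMulVec (fun i => U i k) (fun i => V i k) := by
  have hWv (k : Fin d) : W *ᵥ (fun i => V i k) = σ k • fun i => U i k :=
    hW ▸ sum_smul_vecMulVec_mulVec σ hV k
  have hWu (k : Fin d) : Wᵀ *ᵥ (fun i => U i k) = σ k • fun i => V i k := by
    rw [hW, ← sum_smul_vecMulVec_mulVec σ hU k]
    simp [Matrix.transpose_sum, transpose_vecMulVec]
  have hu (k : Fin d) (s : ℝ) :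
      mpow (W * Wᵀ) s *ᵥ (fun i => U i k) = (σ k ^ 2) ^ s • fun i => U i k := by
    refine mpow_mulVec_of_eigenvector (by simpa using isHermitian_mul_conjTranspose_self W) ?_ s
    rw [← mulVec_mulVec, hWu, mulVec_smul, hWv, smul_smul, sq]
  have hv (k : Fin d) (s : ℝ) :
      (fun i => V i k) ᵥ* mpow (Wᵀ * W) s = (σ k ^ 2) ^ s • fun i => V i k := by
    rw [← mpow_transpose, vecMul_transpose]
    refine mpow_mulVec_of_eigenvector (by simpa using isHermitian_conjTranspose_mul_self W) ?_ s
    rw [← mulVec_mulVec, hWv, mulVec_smul, hWu, smul_smul, sq]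
  have hint (k l : Fin d) (s : ℝ) :
      mpow (W * Wᵀ) (1 - s) * vecMulVec (fun i => U i k) (fun i => V i l) * mpow (Wᵀ * W) s
        = ((σ k ^ 2) ^ (1 - s) * (σ l ^ 2) ^ s) •
          vecMulVec (fun i => U i k) (fun i => V i l) := by
    rw [mul_vecMulVec, vecMulVec_mul, hu, hv, smul_vecMulVec, vecMulVec_smul, smul_smul]
  have hpos (k : Fin d) : 0 < σ k ^ 2 := pow_pos (hσ k) 2
  intro k l
  simp_rw [hint, intervalIntegral.integral_smul_const]
  refine ⟨fun hkl => ?_, ?_⟩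
  · rw [integral_rpow_one_sub_mul_rpow (hpos k) (hpos l)
      fun h => hkl ((sq_eq_sq₀ (hσ k).le (hσ l).le).1 h), ← div_pow, Real.log_pow]
    norm_num
  · simp [← Real.rpow_add (hpos k)]
end
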